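/- Let (X,S) be a biquandle with S∘S = id, and consider the singular pair (X,S,S). Let ∼ be the equivalence relation on X×X generated by (y,z) ∼ (S¹(x,y), S¹(S²(x,y), z)) for all x,y,z ∈ X. Then the abelianization of the universal group U_nc^{fh}(X,S,S) is isomorphic to the free abelian group on the quotient set (X×X)/∼, and under this isomorphism the universal cocycle pair is given by h(x,y) = [(x,y)] (the class of (x,y)) and f(x,y) = [(x,y)]·[S(x,y)]⁻¹. -/

import Mathlib

namespace Paper

/-- The flip map on `X × X`. -/
def flipMap (X : Type*) : X × X → X × X := fun p => (p.2, p.1)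

/-- `F × id` acting on triples. -/
def onFst {X : Type*} (F : X × X → X × X) : X × X × X → X × X × X :=
  fun p => ((F (p.1, p.2.1)).1, (F (p.1, p.2.1)).2, p.2.2)

/-- `id × F` acting on triples. -/
def onSnd {X : Type*} (F : X × X → X × X) : X × X × X → X × X × X :=
  fun p => (p.1, F p.2)

/-- `F` is left invertible: for all `x z` there is a unique `y` with `F¹(x,y) = z`. -/
def LeftInvertible {X : Type*} (F : X × X → X × X) : Prop :=
  ∀ x z : X, ∃! y : X, (F (x, y)).1 = z

/-- `F` is right invertible: for all `y t` there is a unique `x` with `F²(x,y) = t`. -/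
def RightInvertible {X : Type*} (F : X × X → X × X) : Prop :=
  ∀ y t : X, ∃! x : X, (F (x, y)).2 = t

/-- Set-theoretic solution of the Yang–Baxter equation. -/
def IsYB {X : Type*} (S : X × X → X × X) : Prop :=
  Function.Bijective S ∧
    onSnd S ∘ onFst S ∘ onSnd S = onFst S ∘ onSnd S ∘ onFst S

/-- Biquandle: a left and right invertible YB solution together with a bijection
`s : X → X` parametrizing the fixed points of `S`. -/
def IsBiquandle {X : Type*} (S : X × X → X × X) : Prop :=
  IsYB S ∧ LeftInvertible S ∧ RightInvertible S ∧
    ∃ s : X → X, Function.Bijective s ∧ ∀ x y : X, S (x, y) = (x, y) ↔ y = s x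

/-- `(X, S, τ)` is a singular pair. -/
def IsSingularPair {X : Type*} (S τ : X × X → X × X) : Prop :=
  IsBiquandle S ∧ Function.Bijective τ ∧ LeftInvertible τ ∧ RightInvertible τ ∧
    τ ∘ S = S ∘ τ ∧
    onFst S ∘ onSnd S ∘ onFst τ = onSnd τ ∘ onFst S ∘ onSnd S ∧
    onSnd S ∘ onFst S ∘ onSnd τ = onFst τ ∘ onSnd S ∘ onFst S

/-- Generator of type `f` in the free group on `(X×X) ⊕ (X×X)`. -/
def genF {X : Type*} (p : X × X) : FreeGroup ((X × X) ⊕ (X × X)) :=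
  FreeGroup.of (Sum.inl p)

/-- Generator of type `h` in the free group on `(X×X) ⊕ (X×X)`. -/
def genH {X : Type*} (p : X × X) : FreeGroup ((X × X) ⊕ (X × X)) :=
  FreeGroup.of (Sum.inr p)

/-- The relations of the universal group `U_nc^{fh}(X,S,τ)`. -/
def uncRels {X : Type*} (S τ : X × X → X × X) : Set (FreeGroup ((X × X) ⊕ (X × X))) :=
  ⋃ (x : X) (y : X) (z : X),
    { -- (f1)
      genF (x, y) * genF ((S (x, y)).2, z) *
        (genF (x, (S (y, z)).1) * genF ((S (x, (S (y, z)).1)).2, (S (y, z)).2))⁻¹,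
      -- (f4)
      genF (x, y) * genF ((S (x, y)).2, z) *
        (genF (x, (τ (y, z)).1) * genF ((S (x, (τ (y, z)).1)).2, (τ (y, z)).2))⁻¹,
      -- (h1)
      genH ((S (x, y)).1, (S ((S (x, y)).2, z)).1) * (genH (y, z))⁻¹,
      -- (c1)
      genF (x, (S (y, z)).1) * genH ((S (x, (S (y, z)).1)).2, (S (y, z)).2) *
        (genH (x, y) * genF ((τ (x, y)).2, z))⁻¹,
      -- (c2)
      genF (y, z) * genH ((S (x, (S (y, z)).1)).2, (S (y, z)).2) *
        (genH (x, y) * genF ((τ (x, y)).1, (S ((τ (x, y)).2, z)).1))⁻¹,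
      -- (c3)
      genH (x, y) * (genF (x, y) * genH (S (x, y)))⁻¹,
      -- (c4)
      genH (S (x, y)) * (genH (x, y) * genF (τ (x, y)))⁻¹ }

/-- The universal group `U_nc^{fh}(X,S,τ)`. -/
def Unc {X : Type*} (S τ : X × X → X × X) : Type _ :=
  PresentedGroup (uncRels S τ)

instance {X : Type*} (S τ : X × X → X × X) : Group (Unc S τ) :=
  inferInstanceAs (Group (PresentedGroup (uncRels S τ)))

/-- The universal map `π_f`. -/
def piF {X : Type*} (S τ : X × X → X × X) : X × X → Unc S τ :=
  fun p => PresentedGroup.of (rels := uncRels S τ) (Sum.inl p)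

/-- The universal map `π_h`. -/
def piH {X : Type*} (S τ : X × X → X × X) : X × X → Unc S τ :=
  fun p => PresentedGroup.of (rels := uncRels S τ) (Sum.inr p)

/-- The relation `(y,z) ∼ (S¹(x,y), S¹(S²(x,y),z))` on `X × X`; the quotient `Quot (simRel S)`
is by the equivalence relation it generates. -/
def simRel {X : Type*} (S : X × X → X × X) : X × X → X × X → Prop :=
  fun p q => ∃ x : X, q = ((S (x, p.1)).1, (S ((S (x, p.1)).2, p.2)).1)

/-- For an involutive solution, any function `h` invariant under `simRel S` gives, together with
`f = h - h ∘ S`, values in an abelian group satisfying the defining relations of `Unc S S`. -/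
lemma lift_uncRels_eq_one {X M : Type*} [AddCommGroup M] {S : X × X → X × X} (hS : IsYB S)
    (hinv : S ∘ S = id) (h : X × X → M) (hh : ∀ p q, simRel S p q → h p = h q) :
    ∀ r ∈ uncRels S S,
      FreeGroup.lift (Sum.elim (fun p => Multiplicative.ofAdd (h p - h (S p)))
        (fun p => Multiplicative.ofAdd (h p))) r = 1 := by
  intro r hr
  simp only [uncRels, Set.mem_iUnion] at hr
  obtain ⟨x, y, z, hr⟩ := hr
  have hSS (p : X × X) : S (S p) = p := congrFun hinv p
  have hA (t : X × X × X) : onFst S (onFst S t) = t := by simp [onFst, hSS]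
  have hB (t : X × X × X) : onSnd S (onSnd S t) = t := by simp [onSnd, hSS]
  have hYB (t : X × X × X) :
      onSnd S (onFst S (onSnd S t)) = onFst S (onSnd S (onFst S t)) := congrFun hS.2 t
  let H (t : X × X × X) : M := h (t.1, t.2.1)
  have hsnd (t : X × X × X) : h t.2 = H (onSnd S (onFst S t)) := hh _ _ ⟨t.1, rfl⟩
  obtain ⟨t, ht⟩ : ∃ t : X × X × X, t = (x, y, z) := ⟨_, rfl⟩
  have e1 := hsnd t
  have e2 := hsnd (onSnd S t)
  have e3 := hsnd (onFst S t)
  have e4 := hsnd (onSnd S (onFst S t))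
  have e5 := hsnd (onFst S (onSnd S t))
  have e6 := hsnd (onSnd S (onFst S (onSnd S t)))
  simp only [hYB, hA, hB] at e1 e2 e3 e4 e5 e6
  rw [← hYB] at e6
  subst ht
  simp only [H, onFst, onSnd] at e1 e2 e3 e4 e5 e6
  simp only [Set.mem_insert_iff, Set.mem_singleton_iff] at hr
  rcases hr with rfl | rfl | rfl | rfl | rfl | rfl | rfl <;>
    simp only [genF, genH, map_mul, map_inv, FreeGroup.lift_apply_of, Sum.elim_inl, Sum.elim_inr,
      mul_inv_eq_one, ← ofAdd_add, EmbeddingLike.apply_eq_iff_eq, hSS] <;>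
    grind

/-- for an involutive biquandle `(X,S)` and the singular pair `(X,S,S)`,
the abelianization of `U_nc^{fh}(X,S,S)` is the free abelian group on `(X×X)/∼`, with the
universal cocycle pair given by `h(x,y) = [(x,y)]` and `f(x,y) = [(x,y)]·[S(x,y)]⁻¹`. -/
theorem abelianization_Unc_involutive {X : Type*} (S : X × X → X × X)
    (hS : IsBiquandle S) (hinv : S ∘ S = id) :
    ∃ φ : Abelianization (Unc S S) ≃* Multiplicative (FreeAbelianGroup (Quot (simRel S))),
      ∀ x y : X,
        φ (Abelianization.of (piH S S (x, y))) =
          Multiplicative.ofAdd (FreeAbelianGroup.of (Quot.mk (simRel S) (x, y))) ∧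
        φ (Abelianization.of (piF S S (x, y))) =
          Multiplicative.ofAdd (FreeAbelianGroup.of (Quot.mk (simRel S) (x, y)) -
            FreeAbelianGroup.of (Quot.mk (simRel S) (S (x, y)))) := by
  let h (p : X × X) := FreeAbelianGroup.of (Quot.mk (simRel S) p)
  let F : Unc S S →* Multiplicative (FreeAbelianGroup (Quot (simRel S))) :=
    PresentedGroup.toGroup (lift_uncRels_eq_one hS.1 hinv h fun p q hpq =>
      congrArg FreeAbelianGroup.of (Quot.sound hpq))
  have hFh (p) : F (piH S S p) = Multiplicative.ofAdd (h p) := PresentedGroup.toGroup.of _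
  have hFf (p) : F (piF S S p) = Multiplicative.ofAdd (h p - h (S p)) :=
    PresentedGroup.toGroup.of _
  have hsim (p q : X × X) (hpq : simRel S p q) : piH S S p = piH S S q := by
    obtain ⟨x, rfl⟩ := hpq
    refine (mul_inv_eq_one.1 <| PresentedGroup.one_of_mem (rels := uncRels S S) ?_).symm
    simp only [uncRels, Set.mem_iUnion]
    exact ⟨x, p.1, p.2, .inr (.inr (.inl rfl))⟩
  have hpiF (p : X × X) : piF S S p = piH S S p * (piH S S (S p))⁻¹ := by
    refine eq_mul_inv_of_mul_eq
      (mul_inv_eq_one.1 <| PresentedGroup.one_of_mem (rels := uncRels S S) ?_).symm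
    simp only [uncRels, Set.mem_iUnion]
    exact ⟨p.1, p.2, p.1, .inr (.inr (.inr (.inr (.inr (.inl rfl)))))⟩
  let G : Multiplicative (FreeAbelianGroup (Quot (simRel S))) →* Abelianization (Unc S S) :=
    AddMonoidHom.toMultiplicativeLeft <| FreeAbelianGroup.lift <| Quot.lift
      (fun p => Additive.ofMul (Abelianization.of (piH S S p)))
      fun p q hpq => by rw [hsim p q hpq]
  have hG (p) : G (Multiplicative.ofAdd (h p)) = Abelianization.of (piH S S p) :=
    congrArg Additive.toMul (FreeAbelianGroup.lift_apply_of _ _)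
  refine ⟨(Abelianization.lift F).toMulEquiv G ?_ ?_, fun x y => ⟨?_, ?_⟩⟩
  · ext u
    refine DFunLike.congr_fun (f := (G.comp F)) (g := Abelianization.of) ?_ u
    refine PresentedGroup.ext (rels := uncRels S S) ?_
    rintro (p | p)
    · change G (F (piF S S p)) = Abelianization.of (piF S S p)
      rw [hFf, hpiF, ofAdd_sub, map_div, hG, hG, map_mul, map_inv, div_eq_mul_inv]
    · change G (F (piH S S p)) = Abelianization.of (piH S S p)
      rw [hFh, hG]
  · apply AddMonoidHom.toMultiplicative.symm.injective
    ext p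
    obtain ⟨p, rfl⟩ := Quot.exists_rep p
    change Abelianization.lift F (G (Multiplicative.ofAdd (h p))) = Multiplicative.ofAdd (h p)
    rw [hG, Abelianization.lift_apply_of, hFh]
  · exact hFh (x, y)
  · exact hFf (x, y)

end Paper
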